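/- arXiv:2202.06765 — 8 statements merged into one kernel-verified Lean document; each statement's English description precedes it below -/
import Mathlib

section
/- (Galois connection between wlp and sp, Theorem 5.1.) For every type Σ of states, every map R : Σ → Set Σ, and all quantities g, f : Σ → EReal, one has g ≤ wlp R f (pointwise) if and only if sp R g ≤ f (pointwise). -/
noncomputable def wlp {St : Type*} (R : St → Set St) (f : St → EReal) : St → EReal :=
  fun σ => sInf (f '' R σ)

noncomputable def sp {St : Type*} (R : St → Set St) (g : St → EReal) : St → EReal :=
  fun τ => sSup (g '' {σ | τ ∈ R σ})

theorem wlp_sp_galois {St : Type*} (R : St → Set St) (g f : St → EReal) :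
    g ≤ wlp R f ↔ sp R g ≤ f := by
  constructor
  · intro h τ
    refine sSup_le ?_
    rintro _ ⟨σ, hσ, rfl⟩
    exact (h σ).trans (sInf_le ⟨τ, hσ, rfl⟩)
  · intro h σ
    refine le_sInf ?_
    rintro _ ⟨τ, hτ, rfl⟩
    have h1 : g σ ≤ sp R g τ := le_sSup ⟨σ, hτ, rfl⟩
    exact h1.trans (h τ)
end

section
/- (Sublinearity of wp.) For every type Σ of states, every map R : Σ → Set Σ, every real number r with 0 ≤ r, and all quantities f, g : Σ → EReal, one has wp R (fun σ => (r : EReal) * f σ + g σ) ≤ fun σ => (r : EReal) * wp R f σ + wp R g σ, pointwise. -/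
noncomputable def wp {St : Type*} (R : St → Set St) (f : St → EReal) : St → EReal :=
  fun σ => sSup (f '' R σ)

theorem wp_sublinear {St : Type*} (R : St → Set St) (r : ℝ) (hr : 0 ≤ r)
    (f g : St → EReal) :
    wp R (fun σ => (r : EReal) * f σ + g σ) ≤
      fun σ => (r : EReal) * wp R f σ + wp R g σ := by
  intro σ
  refine sSup_le ?_
  rintro _ ⟨τ, hτ, rfl⟩
  exact add_le_add
    (mul_le_mul_of_nonneg_left (le_sSup (Set.mem_image_of_mem f hτ)) (EReal.coe_nonneg.mpr hr))
    (le_sSup (Set.mem_image_of_mem g hτ))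
end

section
/- (Sublinearity of sp.) For every type Σ of states, every map R : Σ → Set Σ, every real number r with 0 ≤ r, and all quantities f, g : Σ → EReal, one has sp R (fun σ => (r : EReal) * f σ + g σ) ≤ fun τ => (r : EReal) * sp R f τ + sp R g τ, pointwise. -/
theorem sp_sublinear {St : Type*} (R : St → Set St) (r : ℝ) (hr : 0 ≤ r)
    (f g : St → EReal) :
    sp R (fun σ => (r : EReal) * f σ + g σ) ≤
      fun τ => (r : EReal) * sp R f τ + sp R g τ := by
  intro τ
  refine sSup_le ?_
  rintro _ ⟨σ, hσ, rfl⟩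
  have hf : f σ ≤ sp R f τ := le_sSup ⟨σ, hσ, rfl⟩
  have hg : g σ ≤ sp R g τ := le_sSup ⟨σ, hσ, rfl⟩
  exact add_le_add (mul_le_mul_of_nonneg_left hf (EReal.coe_nonneg.mpr hr)) hg
end

section
/- (Superlinearity of wlp.) For every type Σ of states, every map R : Σ → Set Σ, every real number r with 0 ≤ r, and all quantities f, g : Σ → EReal, one has (fun σ => (r : EReal) * wlp R f σ + wlp R g σ) ≤ wlp R (fun σ => (r : EReal) * f σ + g σ), pointwise. -/
theorem wlp_superlinear {St : Type*} (R : St → Set St) (r : ℝ) (hr : 0 ≤ r)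
    (f g : St → EReal) :
    (fun σ => (r : EReal) * wlp R f σ + wlp R g σ) ≤
      wlp R (fun σ => (r : EReal) * f σ + g σ) := by
  intro σ
  refine le_sInf ?_
  rintro _ ⟨τ, hτ, rfl⟩
  have h0 : (0 : EReal) ≤ (r : EReal) := EReal.coe_nonneg.mpr hr
  exact add_le_add
    (mul_le_mul_of_nonneg_left (sInf_le (Set.mem_image_of_mem f hτ)) h0)
    (sInf_le (Set.mem_image_of_mem g hτ))
end

section
/- (Superlinearity of slp.) For every type Σ of states, every map R : Σ → Set Σ, every real number r with 0 ≤ r, and all quantities f, g : Σ → EReal, one has (fun τ => (r : EReal) * slp R f τ + slp R g τ) ≤ slp R (fun σ => (r : EReal) * f σ + g σ), pointwise. -/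
noncomputable def slp {St : Type*} (R : St → Set St) (g : St → EReal) : St → EReal :=
  fun τ => sInf (g '' {σ | τ ∈ R σ})

theorem slp_superlinear {St : Type*} (R : St → Set St) (r : ℝ) (hr : 0 ≤ r)
    (f g : St → EReal) :
    (fun τ => (r : EReal) * slp R f τ + slp R g τ) ≤
      slp R (fun σ => (r : EReal) * f σ + g σ) := by
  intro τ
  refine le_sInf ?_
  rintro _ ⟨σ, hσ, rfl⟩
  have hf : slp R f τ ≤ f σ := sInf_le ⟨σ, hσ, rfl⟩
  have hg : slp R g τ ≤ g σ := sInf_le ⟨σ, hσ, rfl⟩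
  exact add_le_add (mul_le_mul_of_nonneg_left hf (EReal.coe_nonneg.mpr hr)) hg
end

section
/- (Embedding of classical strongest postconditions into sp.) For every type Σ of states, every map R : Σ → Set Σ, and every predicate G : Σ → Prop, sp R ⟦G⟧ = ⟦fun τ => ∃ σ, τ ∈ R σ ∧ G σ⟧; that is, the quantitative strongest post of the indicator of G is the indicator of the classical strongest postcondition {τ | ∃ σ, τ ∈ R σ ∧ G σ}. -/
open Classical in
noncomputable def indicator {St : Type*} (P : St → Prop) : St → EReal :=
  fun σ => if P σ then ⊤ else ⊥

theorem sp_embeds_classical_sp {St : Type*} (R : St → Set St) (G : St → Prop) :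
    sp R (indicator G) = indicator (fun τ => ∃ σ, τ ∈ R σ ∧ G σ) := by
  funext τ
  by_cases h : ∃ σ, τ ∈ R σ ∧ G σ
  · have e : indicator (fun τ => ∃ σ, τ ∈ R σ ∧ G σ) τ = ⊤ := if_pos h
    rw [e]
    obtain ⟨σ, h1, h2⟩ := h
    exact top_le_iff.mp (le_sSup ⟨σ, h1, if_pos h2⟩)
  · have e : indicator (fun τ => ∃ σ, τ ∈ R σ ∧ G σ) τ = ⊥ := if_neg h
    rw [e]
    refine le_bot_iff.mp (sSup_le ?_)
    rintro _ ⟨σ, h1, rfl⟩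
    exact le_of_eq (if_neg fun h2 => h ⟨σ, h1, h2⟩)
end

section
/- (Embedding of classical strongest liberal postconditions into slp.) For every type Σ of states, every map R : Σ → Set Σ, and every predicate G : Σ → Prop, slp R ⟦G⟧ = ⟦fun τ => ∀ σ, τ ∈ R σ → G σ⟧; that is, the quantitative strongest liberal post of the indicator of G is the indicator of the set of final states that are reached only from initial states satisfying G (in particular, every unreachable state satisfies it). -/
theorem slp_embeds_classical_slp {St : Type*} (R : St → Set St) (G : St → Prop) :
    slp R (indicator G) = indicator (fun τ => ∀ σ, τ ∈ R σ → G σ) := by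
  funext τ
  by_cases h : ∀ σ, τ ∈ R σ → G σ
  · have h2 : indicator (fun τ => ∀ σ, τ ∈ R σ → G σ) τ = ⊤ := if_pos h
    rw [h2]
    refine sInf_eq_top.2 ?_
    rintro _ ⟨σ, hσ, rfl⟩
    exact if_pos (h σ hσ)
  · have h2 : indicator (fun τ => ∀ σ, τ ∈ R σ → G σ) τ = ⊥ := if_neg h
    rw [h2]
    push Not at h
    obtain ⟨σ, hσ, hG⟩ := h
    refine le_bot_iff.1 (sInf_le ⟨σ, hσ, ?_⟩)
    exact if_neg hG
end

section
/- (Immediate convergence of the sp loop iteration.) Let Σ be a type, φ : Σ → Prop a loop guard, S : (Σ → EReal) →o (Σ → EReal) a monotone map (the strongest post transformer of the loop body) that is strict, i.e. S (fun _ => (⊥ : EReal)) = fun _ => (⊥ : EReal), and let f : Σ → EReal satisfy S f ≤ f (pointwise). Let Ψ_f X = fun τ => max (f τ) (S (fun σ => if φ σ then X σ else ⊥) τ). Then lfp Ψ_f = f, and consequently the strongest post of the loop while(φ){C} with respect to f equals fun τ => if φ τ then (⊥ : EReal) else f τ (i.e. [¬φ] ⋏ f). -/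
open Classical

/-- The `sp`-characteristic function `Ψ_f X = f ⋎ S([φ] ⋏ X)` of a loop
`while(φ){C}` whose body has monotone strongest post transformer `S`. -/
noncomputable def spChar {St : Type*} (φ : St → Prop)
    (S : (St → EReal) →o (St → EReal)) (f : St → EReal) :
    (St → EReal) →o (St → EReal) :=
  ⟨fun X τ => max (f τ) (S (fun σ => if φ σ then X σ else ⊥) τ), by
    intro X Y hXY τ
    dsimp only
    refine max_le_max le_rfl (S.mono ?_ τ)
    intro σ
    dsimp only
    split
    · exact hXY σ
    · exact le_rfl⟩

theorem sp_loop_immediate_convergence {St : Type*} (φ : St → Prop)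
    (S : (St → EReal) →o (St → EReal))
    (hstrict : S (fun _ => (⊥ : EReal)) = fun _ => (⊥ : EReal))
    (f : St → EReal) (hf : S f ≤ f) :
    OrderHom.lfp (spChar φ S f) = f ∧
    (fun τ => if φ τ then (⊥ : EReal) else OrderHom.lfp (spChar φ S f) τ) =
      (fun τ => if φ τ then (⊥ : EReal) else f τ) := by
  have h : OrderHom.lfp (spChar φ S f) = f := by
    apply le_antisymm
    · apply OrderHom.lfp_le
      intro τ
      refine max_le le_rfl (le_trans (S.mono ?_ τ) (hf τ))
      intro σ
      dsimp only
      split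
      · exact le_rfl
      · exact bot_le
    · rw [← OrderHom.map_lfp]
      intro τ
      exact le_max_left _ _
  exact ⟨h, by rw [h]⟩
end
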